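/- Let X be a special (abstract) rank one group with unipotent subgroups A and B, and suppose |A| ≥ 4. Then A ⊆ [X,X], i.e., A is contained in the commutator subgroup of X. -/

import Mathlib

/-- The conjugate subgroup `S^g = g⁻¹ S g`. -/
def conjSub {X : Type*} [Group X] (S : Subgroup X) (g : X) : Subgroup X :=
  S.map (MulAut.conj g⁻¹).toMonoidHom

/-- `X` is an (abstract) rank one group with unipotent subgroups `A` and `B`:
`A ≠ B`, `X = ⟨A, B⟩`, for each `1 ≠ a ∈ A` there is `1 ≠ b ∈ B` with `A^b = B^a`,
and vice versa. -/
structure IsRankOneGroup {X : Type*} [Group X] (A B : Subgroup X) : Prop where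
  ne : A ≠ B
  gen : A ⊔ B = ⊤
  exB : ∀ a ∈ A, a ≠ 1 → ∃ b ∈ B, b ≠ 1 ∧ conjSub A b = conjSub B a
  exA : ∀ b ∈ B, b ≠ 1 → ∃ a ∈ A, a ≠ 1 ∧ conjSub B a = conjSub A b

/-- `bf` implements `a ↦ b(a)`, the unique `1 ≠ b ∈ B` with `A^b = B^a`, for `1 ≠ a ∈ A`. -/
def IsBFun {X : Type*} [Group X] (A B : Subgroup X) (bf : X → X) : Prop :=
  ∀ a ∈ A, a ≠ 1 → bf a ∈ B ∧ bf a ≠ 1 ∧ conjSub A (bf a) = conjSub B a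

/-- `af` implements `b ↦ a(b)`, the unique `1 ≠ a ∈ A` with `B^a = A^b`, for `1 ≠ b ∈ B`. -/
def IsAFun {X : Type*} [Group X] (A B : Subgroup X) (af : X → X) : Prop :=
  ∀ b ∈ B, b ≠ 1 → af b ∈ A ∧ af b ≠ 1 ∧ conjSub B (af b) = conjSub A b

/-- `X` is special: `b(a⁻¹) = b(a)⁻¹` for all `1 ≠ a ∈ A`. -/
def IsSpecialBFun {X : Type*} [Group X] (A B : Subgroup X) (bf : X → X) : Prop :=
  IsBFun A B bf ∧ ∀ a ∈ A, a ≠ 1 → bf a⁻¹ = (bf a)⁻¹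

/-- The special rank one group condition, phrased without a chosen `b`-function. -/
def IsSpecial {X : Type*} [Group X] (A B : Subgroup X) : Prop :=
  ∃ bf : X → X, IsSpecialBFun A B bf

theorem mem_conjSub {X : Type*} [Group X] {S : Subgroup X} {g x : X} :
    x ∈ conjSub S g ↔ g * x * g⁻¹ ∈ S := by
  simp only [conjSub, Subgroup.mem_map, MulEquiv.coe_toMonoidHom, MulAut.conj_apply, inv_inv]
  constructor
  · rintro ⟨s, hs, rfl⟩
    simpa [mul_assoc] using hs
  · intro hx
    exact ⟨_, hx, by group⟩

theorem conjSub_mul {X : Type*} [Group X] (S : Subgroup X) (g k : X) :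
    conjSub S (g * k) = conjSub (conjSub S g) k := by
  ext x
  simp only [mem_conjSub, mul_inv_rev, mul_assoc]

theorem conjSub_one {X : Type*} [Group X] (S : Subgroup X) : conjSub S 1 = S := by
  ext x
  simp [mem_conjSub]

theorem conjSub_of_mem {X : Type*} [Group X] {S : Subgroup X} {g : X} (hg : g ∈ S) :
    conjSub S g = S := by
  ext x
  rw [mem_conjSub, S.mul_mem_cancel_right (S.inv_mem hg), S.mul_mem_cancel_left hg]

/-- Opposite unipotent subgroups act freely: `b` is determined by `A^b`. -/
theorem eq_of_conjSub_eq {X : Type*} [Group X] {A B : Subgroup X} (hne : A ≠ B)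
    (hex : ∀ b ∈ B, b ≠ 1 → ∃ a ∈ A, a ≠ 1 ∧ conjSub B a = conjSub A b)
    {b c : X} (hb : b ∈ B) (hc : c ∈ B) (hbc : conjSub A b = conjSub A c) : b = c := by
  by_contra hn
  obtain ⟨a, ha, -, hab⟩ := hex (b * c⁻¹) (B.mul_mem hb (B.inv_mem hc))
    (fun h => hn (mul_inv_eq_one.mp h))
  have hBA : conjSub B a = conjSub A a := by
    rw [hab, conjSub_mul, hbc, ← conjSub_mul, mul_inv_cancel, conjSub_one, conjSub_of_mem ha]
  apply hne
  have := congrArg (fun S => conjSub S a⁻¹) hBA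
  simpa [← conjSub_mul, conjSub_one] using this.symm

section Special

variable {X : Type*} [Group X] {A B : Subgroup X} {bf : X → X}

theorem IsRankOneGroup.bFun_injOn (h : IsRankOneGroup A B) (hb : IsBFun A B bf)
    {a x : X} (ha : a ∈ A) (ha1 : a ≠ 1) (hx : x ∈ A) (hx1 : x ≠ 1) (hax : bf a = bf x) :
    a = x :=
  eq_of_conjSub_eq h.ne.symm h.exB ha hx <| by
    rw [← (hb a ha ha1).2.2, ← (hb x hx hx1).2.2, hax]

theorem IsRankOneGroup.exists_bFun_eq (h : IsRankOneGroup A B) (hb : IsBFun A B bf)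
    {b : X} (hbB : b ∈ B) (hb1 : b ≠ 1) : ∃ a ∈ A, a ≠ 1 ∧ bf a = b := by
  obtain ⟨a, ha, ha1, hab⟩ := h.exA b hbB hb1
  obtain ⟨hB, -, hconj⟩ := hb a ha ha1
  exact ⟨a, ha, ha1, eq_of_conjSub_eq h.ne h.exA hB hbB (hconj.trans hab)⟩

/-- In a special rank one group, `b(a)⁻¹ a b(a)⁻¹` conjugates `A` to `B`. -/
theorem IsSpecialBFun.conjSub_left (hs : IsSpecialBFun A B bf) {a : X} (ha : a ∈ A)
    (ha1 : a ≠ 1) : conjSub A ((bf a)⁻¹ * a * (bf a)⁻¹) = B := by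
  have h1 := (hs.1 a⁻¹ (A.inv_mem ha) (inv_ne_one.mpr ha1)).2.2
  rw [hs.2 a ha ha1] at h1
  rw [conjSub_mul, conjSub_mul, h1, ← conjSub_mul B, inv_mul_cancel, conjSub_one,
    conjSub_of_mem (B.inv_mem (hs.1 a ha ha1).1)]

/-- In a special rank one group, `b(a)⁻¹ a b(a)⁻¹` conjugates `B` to `A`. -/
theorem IsSpecialBFun.conjSub_right (hs : IsSpecialBFun A B bf) {a : X} (ha : a ∈ A)
    (ha1 : a ≠ 1) : conjSub B ((bf a)⁻¹ * a * (bf a)⁻¹) = A := by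
  obtain ⟨hB, -, hconj⟩ := hs.1 a ha ha1
  rw [conjSub_mul, conjSub_mul, conjSub_of_mem (B.inv_mem hB), ← hconj, ← conjSub_mul,
    mul_inv_cancel, conjSub_one]

/-- Conjugation by `n = b(a)⁻¹ a b(a)⁻¹` sends `x ∈ A` to `b(y)`, where `B^y = B^(x n)`. -/
theorem IsRankOneGroup.conj_eq_bFun (h : IsRankOneGroup A B) (hs : IsSpecialBFun A B bf)
    {a x y : X} (ha : a ∈ A) (ha1 : a ≠ 1) (hx : x ∈ A) (hy : y ∈ A) (hy1 : y ≠ 1)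
    (hxy : conjSub B (x * ((bf a)⁻¹ * a * (bf a)⁻¹)) = conjSub B y) :
    ((bf a)⁻¹ * a * (bf a)⁻¹)⁻¹ * x * ((bf a)⁻¹ * a * (bf a)⁻¹) = bf y := by
  have hA := hs.conjSub_left ha ha1
  have hB := hs.conjSub_right ha ha1
  obtain ⟨hyB, -, hconj⟩ := hs.1 y hy hy1
  generalize (bf a)⁻¹ * a * (bf a)⁻¹ = n at *
  refine eq_of_conjSub_eq h.ne h.exA ?_ hyB ?_
  · rw [← hA, mem_conjSub]
    simpa [mul_assoc] using hx
  · have hinv : conjSub A n⁻¹ = B := by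
      rw [← hB, ← conjSub_mul, mul_inv_cancel, conjSub_one]
    rw [hconj, mul_assoc, conjSub_mul, hinv, hxy]

/-- Homomorphisms to commutative groups invert `b`. -/
theorem IsRankOneGroup.map_bFun (h : IsRankOneGroup A B) (hs : IsSpecialBFun A B bf)
    {Q : Type*} [CommGroup Q] (f : X →* Q) {a : X} (ha : a ∈ A) (ha1 : a ≠ 1) :
    f (bf a) = (f a)⁻¹ := by
  have hinv := A.inv_mem ha
  have hinv1 := inv_ne_one.mpr ha1
  have h1 := (hs.1 a⁻¹ hinv hinv1).2.2
  rw [hs.2 a ha ha1] at h1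
  have key := h.conj_eq_bFun hs ha ha1 ha hinv hinv1 (by
    rw [← h1, ← mul_assoc, ← mul_assoc, conjSub_mul, conjSub_mul, conjSub_mul,
      ← (hs.1 a ha ha1).2.2, ← conjSub_mul A, mul_inv_cancel, conjSub_one, conjSub_of_mem ha])
  rw [hs.2 a ha ha1] at key
  have := congrArg f key
  rw [map_mul, map_mul, map_inv, mul_right_comm, inv_mul_cancel, one_mul, map_inv] at this
  rw [this, inv_inv]

theorem IsRankOneGroup.map_mul_self_eq (h : IsRankOneGroup A B) (hs : IsSpecialBFun A B bf)
    {Q : Type*} [CommGroup Q] (f : X →* Q) {a x : X} (ha : a ∈ A) (ha1 : a ≠ 1)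
    (hx : x ∈ A) (hx1 : x ≠ 1) (hax : a ≠ x) : f x * f x = f a := by
  have hb := hs.1
  have haB := (hb a ha ha1).1
  have hdiv : ∀ z ∈ A, z ≠ 1 → z ≠ a → ∃ u ∈ A, u ≠ 1 ∧ bf u = bf z * (bf a)⁻¹ := by
    intro z hz hz1 hza
    exact h.exists_bFun_eq hb (B.mul_mem (hb z hz hz1).1 (B.inv_mem haB))
      fun he => hza (h.bFun_injOn hb hz hz1 ha ha1 (mul_inv_eq_one.mp he))
  obtain ⟨u, hu, hu1, hbu⟩ := hdiv x hx hx1 hax.symm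
  have hua1 : u * a ≠ 1 := by
    intro he
    rw [eq_inv_of_mul_eq_one_left he, hs.2 a ha ha1] at hbu
    exact (hb x hx hx1).2.1 (right_eq_mul.mp hbu)
  have hua := A.mul_mem hu ha
  obtain ⟨w, hw, hw1, hbw⟩ := hdiv (u * a) hua hua1 fun he => hu1 (mul_eq_right.mp he)
  have key := h.conj_eq_bFun hs ha ha1 hx hw hw1 (by
    rw [← (hb w hw hw1).2.2, hbw, conjSub_mul A, (hb _ hua hua1).2.2, conjSub_mul B u,
      ← (hb u hu hu1).2.2, hbu, ← mul_assoc, ← mul_assoc, conjSub_mul, conjSub_mul, conjSub_mul,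
      ← (hb x hx hx1).2.2, ← conjSub_mul A])
  have e1 := congrArg f key
  have e2 := congrArg f hbu
  have e3 := congrArg f hbw
  rw [map_mul, map_mul, map_inv, mul_right_comm, inv_mul_cancel, one_mul] at e1
  rw [map_mul, map_inv, h.map_bFun hs f hu hu1, h.map_bFun hs f hx hx1,
    h.map_bFun hs f ha ha1, inv_inv] at e2
  rw [← e1, map_mul, map_inv, h.map_bFun hs f hua hua1, h.map_bFun hs f ha ha1, inv_inv,
    map_mul, mul_inv, e2, inv_mul_cancel_right] at e3
  nth_rewrite 1 [e3]
  exact inv_mul_cancel_comm _ _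

end Special

/-- In a special rank one group with `|A| ≥ 4`, the subgroup `A` is contained in
the commutator subgroup `[X,X]`. -/
theorem specialRankOne_A_le_commutator {X : Type*} [Group X] (A B : Subgroup X)
    (h : IsRankOneGroup A B) (hsp : IsSpecial A B)
    (hcard : 4 ≤ Cardinal.mk A) :
    A ≤ commutator X := by
  obtain ⟨bf, hs⟩ := hsp
  intro a ha
  by_cases ha1 : a = 1
  · exact ha1 ▸ one_mem _
  have hlt : ∀ l : List A, l.length < 4 → ∃ z : A, z ∉ l := fun l hl =>
    Cardinal.exists_notMem_of_length_lt l (lt_of_lt_of_le (by exact_mod_cast hl) hcard)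
  obtain ⟨⟨x, hx⟩, hxl⟩ := hlt [1, ⟨a, ha⟩] (by simp)
  obtain ⟨⟨y, hy⟩, hyl⟩ := hlt [1, ⟨a, ha⟩, ⟨x, hx⟩] (by simp)
  simp only [List.mem_cons, List.not_mem_nil, or_false, not_or, Subgroup.mk_eq_one,
    Subtype.mk.injEq] at hxl hyl
  obtain ⟨hx1, hxa⟩ := hxl
  obtain ⟨hy1, hya, hyx⟩ := hyl
  let f : X →* Abelianization X := Abelianization.of
  have e1 : f x * f x = f a := h.map_mul_self_eq hs f ha ha1 hx hx1 (Ne.symm hxa)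
  have e2 : f x * f x = f y := h.map_mul_self_eq hs f hy hy1 hx hx1 hyx
  have e3 : f a * f a = f y := h.map_mul_self_eq hs f hy hy1 ha ha1 hya
  rw [← e2, e1] at e3
  rw [← Abelianization.ker_of X, MonoidHom.mem_ker]
  exact mul_eq_left.mp e3
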